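/- arXiv:2408.13710 — 3 statements merged into one kernel-verified Lean document; each statement's English description precedes it below -/
import Mathlib

section
/- Let A be a unital C*-algebra, τ: A_sa → E a bounded tracial map to a real Banach space, and ξ a piecewise smooth path in U(A) with ξ(0) = 1 satisfying ‖ξ(t) − 1‖ < 1 for all t. Then Δ̃_τ(ξ) = (1/2πi)·τ(log ξ(1)), where log is the principal-branch holomorphic functional calculus logarithm. -/
/-- The principal-branch logarithm on the ball `‖w - 1‖ < 1`, given by the power series
`log w = ∑_{n ≥ 1} (-1)^{n+1} (w - 1)^n / n` (holomorphic functional calculus). -/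
noncomputable def cstarLog {A : Type*} [NormedRing A] [NormedAlgebra ℂ A] (w : A) : A :=
  ∑' n : ℕ, (((-1 : ℂ) ^ n / (n + 1)) • (w - 1) ^ (n + 1))

lemma norm_mul_pow_le_mul_pow {R : Type*} [NormedRing R] (a x : R) (n : ℕ) :
    ‖a * x ^ n‖ ≤ ‖a‖ * ‖x‖ ^ n := by
  induction n with
  | zero => simp
  | succ n ih =>
    rw [pow_succ, ← mul_assoc, pow_succ, ← mul_assoc]
    exact (norm_mul_le _ _).trans (mul_le_mul_of_nonneg_right ih (norm_nonneg _))

section CstarLog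

variable {A : Type*} [NormedRing A] [NormedAlgebra ℂ A]

lemma norm_neg_one_pow_div_le_one (n : ℕ) : ‖((-1 : ℂ) ^ n / (n + 1))‖ ≤ 1 := by
  have h : ‖((n : ℂ) + 1)‖ = (n : ℝ) + 1 := by
    rw [← Nat.cast_succ, Complex.norm_natCast, Nat.cast_succ]
  rw [norm_div, norm_pow, norm_neg, norm_one, one_pow, h]
  exact div_le_one_of_le₀ (by linarith [n.cast_nonneg (α := ℝ)]) (by positivity)

lemma summable_cstarLog [CompleteSpace A] {w : A} (hw : ‖w - 1‖ < 1) :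
    Summable fun n : ℕ => ((-1 : ℂ) ^ n / (n + 1)) • (w - 1) ^ (n + 1) := by
  refine Summable.of_norm_bounded
    ((summable_nat_add_iff 1).2 (summable_geometric_of_lt_one (norm_nonneg _) hw)) fun n => ?_
  rw [norm_smul]
  exact (mul_le_of_le_one_left (norm_nonneg _) (norm_neg_one_pow_div_le_one n)).trans
    (norm_pow_le' _ n.succ_pos)

lemma cstarLog_one : cstarLog (1 : A) = 0 := by
  simp [cstarLog]

lemma map_cstarLog [CompleteSpace A] {B : Type*} [NormedRing B] [NormedAlgebra ℂ B]
    (φ : A →ₐ[ℂ] B) (hφ : Continuous φ) {w : A} (hw : ‖w - 1‖ < 1) :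
    φ (cstarLog w) = cstarLog (φ w) := by
  rw [cstarLog, (summable_cstarLog hw).map_tsum φ hφ]
  simp [cstarLog]

lemma Complex.cstarLog_eq_log {z : ℂ} (hz : ‖z - 1‖ < 1) : cstarLog z = Complex.log z := by
  have h := (hasSum_nat_add_iff' 1).2 (Complex.hasSum_taylorSeries_log hz)
  have h' := h.tsum_eq
  simp only [add_sub_cancel, Finset.range_one, Finset.sum_singleton, Nat.cast_zero, div_zero,
    sub_zero] at h'
  rw [← h', cstarLog]
  refine tsum_congr fun n => ?_
  rw [smul_eq_mul, pow_succ (-1 : ℂ) (n + 1), pow_succ (-1 : ℂ) n]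
  push_cast
  ring

variable {E : Type*} [NormedAddCommGroup E] [NormedSpace ℝ E]

open scoped RightActions in
lemma hasFDerivAt_tracial_pow (σ : A →L[ℝ] E) (hσ : ∀ x y, σ (x * y) = σ (y * x))
    (n : ℕ) (w : A) :
    HasFDerivAt (fun w : A => σ (((-1 : ℂ) ^ n / (n + 1)) • (w - 1) ^ (n + 1)))
      (σ ∘L (ContinuousLinearMap.mul ℝ A).flip ((1 - w) ^ n)) w := by
  have h := (σ.hasFDerivAt.comp w
    ((((hasFDerivAt_id w).sub_const 1).pow' (𝕜 := ℝ) (n + 1)).const_smul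
      ((-1 : ℝ) ^ n / (n + 1))))
  have hc (y : A) : ((-1 : ℂ) ^ n / (n + 1)) • y = ((-1 : ℝ) ^ n / (n + 1)) • y := by
    rw [← Complex.coe_smul]; push_cast; rfl
  simp only [hc]
  refine h.congr_fderiv ?_
  ext v
  have hterm : ∀ i ∈ Finset.range (n + 1),
      σ ((w - 1) ^ (n - i) * (v * (w - 1) ^ i)) = σ (v * (w - 1) ^ n) := fun i hi => by
    rw [hσ, mul_assoc, ← pow_add, Nat.add_sub_cancel' (Finset.mem_range_succ_iff.1 hi)]
  have hneg : (1 - w) ^ n = ((-1 : ℝ) ^ n) • (w - 1) ^ n := by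
    rw [← neg_sub, ← neg_one_smul ℝ (w - 1), smul_pow]
  have hn : (n : ℝ) + 1 ≠ 0 := by positivity
  simp [hneg, mul_assoc]
  rw [Finset.sum_congr rfl hterm, Finset.sum_const, Finset.card_range,
    ← Nat.cast_smul_eq_nsmul ℝ, smul_smul]
  push_cast
  congr 1
  field_simp

lemma hasFDerivAt_tracial_cstarLog [CompleteSpace A] [CompleteSpace E]
    (σ : A →L[ℝ] E) (hσ : ∀ x y, σ (x * y) = σ (y * x)) {w v : A}
    (hw : ‖w - 1‖ < 1) (hv : w * v = 1) :
    HasFDerivAt (fun w : A => σ (cstarLog w))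
      (σ ∘L (ContinuousLinearMap.mul ℝ A).flip v) w := by
  obtain ⟨r, hwr, hr⟩ := exists_between hw
  have hr0 : 0 ≤ r := (norm_nonneg _).trans hwr.le
  have hgeom : Summable fun n : ℕ => ‖σ‖ * r ^ n :=
    (summable_geometric_of_lt_one hr0 hr).mul_left _
  have hbound : ∀ (n : ℕ), ∀ x ∈ Metric.ball (1 : A) r,
      ‖σ ∘L (ContinuousLinearMap.mul ℝ A).flip ((1 - x) ^ n)‖ ≤ ‖σ‖ * r ^ n := by
    intro n x hx
    refine ContinuousLinearMap.opNorm_le_bound _ (by positivity) fun a => ?_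
    rw [mem_ball_iff_norm'] at hx
    calc ‖σ (a * (1 - x) ^ n)‖ ≤ ‖σ‖ * (‖a‖ * ‖1 - x‖ ^ n) :=
          (σ.le_opNorm _).trans (by gcongr; exact norm_mul_pow_le_mul_pow _ _ _)
      _ ≤ ‖σ‖ * (‖a‖ * r ^ n) := by gcongr
      _ = ‖σ‖ * r ^ n * ‖a‖ := by ring
  have hwball : w ∈ Metric.ball (1 : A) r := by rwa [mem_ball_iff_norm]
  have hmain := hasFDerivAt_tsum_of_isPreconnected hgeom Metric.isOpen_ball
    (convex_ball (1 : A) r).isPreconnected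
    (fun n x _ => hasFDerivAt_tracial_pow σ hσ n x) hbound hwball
    ((summable_cstarLog hw).map σ σ.continuous) hwball
  have hw' : ‖1 - w‖ < 1 := by rwa [norm_sub_rev]
  have hinv : ∑' n : ℕ, (1 - w) ^ n = v := by
    have h := geom_series_mul_neg (1 - w) hw'
    rw [sub_sub_cancel] at h
    exact left_inv_eq_right_inv h hv
  have hsum : HasSum (fun n : ℕ => (1 - w) ^ n) v :=
    hinv ▸ (summable_geometric_of_norm_lt_one hw').hasSum
  have hfd : ∑' n : ℕ, σ ∘L (ContinuousLinearMap.mul ℝ A).flip ((1 - w) ^ n)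
      = σ ∘L (ContinuousLinearMap.mul ℝ A).flip v :=
    (hsum.mapL ((ContinuousLinearMap.compL ℝ A A E σ) ∘L
      (ContinuousLinearMap.mul ℝ A).flip)).tsum_eq
  rw [hfd] at hmain
  refine hmain.congr_of_eventuallyEq ?_
  filter_upwards [Metric.isOpen_ball.mem_nhds hwball] with x hx
  rw [mem_ball_iff_norm] at hx
  exact (summable_cstarLog (hx.trans hr)).map_tsum σ σ.continuous

end CstarLog

lemma star_cstarLog_of_mem_unitary {A : Type*} [CStarAlgebra A] {u : A} (hu : u ∈ unitary A)
    (h : ‖u - 1‖ < 1) : star (cstarLog u) = -cstarLog u := by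
  have hn : IsStarNormal u := ⟨by
    rw [commute_iff_eq, Unitary.star_mul_self_of_mem hu, Unitary.mul_star_self_of_mem hu]⟩
  set ι : C(spectrum ℂ u, ℂ) := (ContinuousMap.id ℂ).restrict (spectrum ℂ u) with hι
  have hιu : cfcHom hn ι = u := cfcHom_id hn
  have hι1 : ‖ι - 1‖ < 1 := by
    rw [← norm_cfcHom u (ι - 1) hn, map_sub, hιu, map_one]
    exact h
  have hlog : cfcHom hn (cstarLog ι) = cstarLog u := by
    have := map_cstarLog (cfcHom hn : C(spectrum ℂ u, ℂ) →⋆ₐ[ℂ] A).toAlgHom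
      (cfcHom_continuous hn) hι1
    exact this.trans (congrArg cstarLog hιu)
  rw [← hlog, ← map_star, ← map_neg]
  congr 1
  ext z
  have hz1 : ‖(z : ℂ) - 1‖ < 1 := ((ι - 1).norm_coe_le_norm z).trans_lt hι1
  have hval : cstarLog ι z = Complex.log z := by
    rw [← Complex.cstarLog_eq_log hz1]
    exact map_cstarLog (ContinuousMap.evalAlgHom ℂ ℂ z) (continuous_eval_const z) hι1
  have hnorm : ‖(z : ℂ)‖ = 1 := by simpa using spectrum.subset_circle_of_unitary hu z.2
  have harg : Complex.arg z ≠ Real.pi := by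
    have hz : (z : ℂ) ∈ Complex.slitPlane := by
      simpa using Complex.mem_slitPlane_of_norm_lt_one hz1
    exact (Complex.mem_slitPlane_iff_arg.1 hz).1
  rw [ContinuousMap.star_apply, ContinuousMap.neg_apply, hval, ← Complex.log_inv _ harg,
    Complex.inv_eq_conj hnorm, Complex.log_conj _ harg]
  rfl

lemma map_add_star_mul_comm {A E : Type*} [CStarAlgebra A] [NormedAddCommGroup E]
    [NormedSpace ℝ E] (τ : A →L[ℝ] E) (htracial : ∀ a : A, τ (a * star a) = τ (star a * a))
    (x y : A) : τ (x * y + star (x * y)) = τ (y * x + star (y * x)) := by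
  have h := htracial (x + star y)
  simp only [star_add, star_star, add_mul, mul_add, map_add, htracial x] at h
  have hy := htracial (star y)
  rw [star_star] at hy
  rw [hy] at h
  simp only [map_add, star_mul]
  have h' : τ (x * star x) + (τ (x * y) + τ (star y * star x)) + τ (y * star y) = 
    τ (x * star x) + (τ (y * x) + τ (star x * star y)) + τ (y * star y) := by
    rw [htracial x]
    convert h using 1 <;> abel
  simpa using h'

/-- If `ξ` is a piecewise smooth path of unitaries with `ξ(0) = 1` and
`‖ξ(t) − 1‖ < 1` for all `t ∈ [0,1]`, then the pre-determinant
`Δ̃_τ(ξ) = ∫₀¹ τ((2πi)⁻¹ ξ'(t) ξ(t)⁻¹) dt` equals `τ((2πi)⁻¹ log ξ(1))`. -/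
theorem predeterminant_eq_log_of_close_to_one {A E : Type*} [CStarAlgebra A]
    [NormedAddCommGroup E] [NormedSpace ℝ E] [CompleteSpace E]
    (τ : A →L[ℝ] E) (htracial : ∀ a : A, τ (a * star a) = τ (star a * a))
    (ξ d : ℝ → A) (s : Set ℝ) (hs : s.Finite)
    (hcont : ContinuousOn ξ (Set.Icc 0 1))
    (hmem : ∀ t ∈ Set.Icc (0 : ℝ) 1, ξ t ∈ unitary A)
    (h0 : ξ 0 = 1)
    (hclose : ∀ t ∈ Set.Icc (0 : ℝ) 1, ‖ξ t - 1‖ < 1)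
    (hd : ∀ t ∈ Set.Icc (0 : ℝ) 1 \ s, HasDerivAt ξ (d t) t)
    (hint : IntervalIntegrable
      (fun t => τ (((2 * Real.pi * Complex.I : ℂ))⁻¹ • (d t * star (ξ t))))
      MeasureTheory.volume 0 1) :
    ∫ t in (0 : ℝ)..1, τ (((2 * Real.pi * Complex.I : ℂ))⁻¹ • (d t * star (ξ t)))
      = τ (((2 * Real.pi * Complex.I : ℂ))⁻¹ • cstarLog (ξ 1)) := by
  set k : ℂ := (2 * Real.pi * Complex.I)⁻¹ with hk
  have hkstar : star k = -k := by simp [hk]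
  let m : A →L[ℝ] A := (k • ContinuousLinearMap.id ℂ A).restrictScalars ℝ
  let σ : A →L[ℝ] E := (2⁻¹ : ℝ) •
    (τ ∘L (m + ((starL' ℝ : A ≃L[ℝ] A) : A →L[ℝ] A) ∘L m))
  have hσ_apply (z : A) : σ z = (2⁻¹ : ℝ) • τ (k • z + star (k • z)) := rfl
  have hσ (x y : A) : σ (x * y) = σ (y * x) := by
    rw [hσ_apply, hσ_apply, ← smul_mul_assoc, map_add_star_mul_comm τ htracial, mul_smul_comm]
  have hskew {z : A} (hz : star z = -z) : σ z = τ (k • z) := by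
    rw [hσ_apply, star_smul, hkstar, hz, neg_smul_neg, ← two_smul ℝ, map_smul,
      inv_smul_smul₀ two_ne_zero]
  have hfderiv {t : ℝ} (ht : t ∈ Set.Icc (0 : ℝ) 1) :=
    hasFDerivAt_tracial_cstarLog σ hσ (hclose t ht) (Unitary.mul_star_self_of_mem (hmem t ht))
  have hderiv : ∀ t ∈ Set.Ioo (0 : ℝ) 1 \ s,
      HasDerivAt (fun t => σ (cstarLog (ξ t))) (τ (k • (d t * star (ξ t)))) t := by
    rintro t ⟨ht, hts⟩
    have htI := Set.Ioo_subset_Icc_self ht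
    have hdt := hd t ⟨htI, hts⟩
    have hprod : d t * star (ξ t) + ξ t * star (d t) = 0 := by
      refine (hdt.mul hdt.star).unique ((hasDerivAt_const t (1 : A)).congr_of_eventuallyEq ?_)
      filter_upwards [Icc_mem_nhds ht.1 ht.2] with x hx
      exact Unitary.mul_star_self_of_mem (hmem x hx)
    have hst : star (d t * star (ξ t)) = -(d t * star (ξ t)) := by
      rw [star_mul, star_star]
      exact eq_neg_of_add_eq_zero_right hprod
    rw [← hskew hst]
    exact (hfderiv htI).comp_hasDerivAt t hdt
  have hcontlog : ContinuousOn (fun t => σ (cstarLog (ξ t))) (Set.Icc 0 1) := fun t ht =>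
    ContinuousAt.comp_continuousWithinAt (f := ξ) (hfderiv ht).continuousAt (hcont t ht)
  have h1 : (1 : ℝ) ∈ Set.Icc (0 : ℝ) 1 := Set.right_mem_Icc.2 zero_le_one
  rw [MeasureTheory.integral_eq_of_hasDerivAt_off_countable_of_le _ _ zero_le_one hs.countable
    hcontlog hderiv hint, h0, cstarLog_one, map_zero, sub_zero,
    hskew (star_cstarLog_of_mem_unitary (hmem 1 h1) (hclose 1 h1))]
end

section
/- Let A be a unital C*-algebra, τ: A_sa → E a bounded tracial map, and ξ₀, ξ₁ piecewise smooth paths in U(A) from 1 with the same endpoint that are homotopic with fixed endpoints. Then Δ̃_τ(ξ₀) = Δ̃_τ(ξ₁). -/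
open Metric MeasureTheory Set

theorem norm_mul_sub_one_lt_one {A : Type*} [NormedRing A] {x y : A} (hx : ‖x - 1‖ < 1 / 4) (hy : ‖y - 1‖ < 1 / 4) :
    ‖x * y - 1‖ < 1 := by
  have h : x * y - 1 = (x - 1) * (y - 1) + (x - 1) + (y - 1) := by noncomm_ring
  rw [h]
  have h1 := norm_add₃_le (a := (x - 1) * (y - 1)) (b := x - 1) (c := y - 1)
  have h2 := norm_mul_le (x - 1) (y - 1)
  nlinarith [norm_nonneg (x - 1), norm_nonneg (y - 1)]

section Primitive

variable {A E : Type*} [NormedRing A] [NormedAlgebra ℝ A] [CompleteSpace A]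
  [NormedAddCommGroup E] [NormedSpace ℝ E]

/-- A bounded trace `φ` makes the 1-form `h ↦ φ (h * x⁻¹)` closed, hence exact on the unit ball
around `1`. -/
theorem exists_hasFDerivAt_trace_mul_inverse [CompleteSpace E] (φ : A →L[ℝ] E)
    (hφ : ∀ x y, φ (x * y) = φ (y * x)) :
    ∃ L : A → E, L 1 = 0 ∧ ∀ x ∈ ball (1 : A) 1,
      HasFDerivAt L (φ.comp ((ContinuousLinearMap.mul ℝ A).flip (Ring.inverse x))) x := by
  let T : A →L[ℝ] A →L[ℝ] E :=
    (ContinuousLinearMap.compL ℝ A A E φ).comp (ContinuousLinearMap.mul ℝ A).flip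
  have key : ∀ x ∈ ball (1 : A) 1, ∃ u : Aˣ, (u : A) = x := by
    intro x hx
    rw [mem_ball_iff_norm'] at hx
    have := isUnit_one_sub_of_norm_lt_one hx
    rwa [sub_sub_cancel] at this
  have hderiv : ∀ x ∈ ball (1 : A) 1, HasFDerivAt (fun y => T (Ring.inverse y))
      (T.comp (-ContinuousLinearMap.mulLeftRight ℝ A (Ring.inverse x) (Ring.inverse x))) x := by
    intro x hx
    obtain ⟨u, rfl⟩ := key x hx
    rw [Ring.inverse_unit]
    exact T.hasFDerivAt.comp _ (hasFDerivAt_ringInverse u)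
  have hconv := convex_ball (1 : A) 1
  obtain ⟨f, hf⟩ := hconv.exists_forall_hasFDerivWithinAt_of_hasFDerivWithinAt_symmetric
    (fun x hx => (hderiv x hx).hasFDerivWithinAt) (by
      intro x _ h _ k _
      simp only [T, ContinuousLinearMap.comp_apply, neg_apply,
        ContinuousLinearMap.mulLeftRight_apply, map_neg, ContinuousLinearMap.compL_apply,
        ContinuousLinearMap.flip_apply, ContinuousLinearMap.mul_apply']
      rw [← mul_assoc, ← mul_assoc, ← mul_assoc, ← mul_assoc, mul_assoc (k * _), hφ, ← mul_assoc])
  refine ⟨fun x => f x - f 1, sub_self _, fun x hx => ?_⟩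
  exact ((hf x hx).hasFDerivAt (isOpen_ball.mem_nhds hx)).sub_const _

/-- A primitive of `φ (h * x⁻¹)` behaves like a logarithm near `1`. -/
theorem primitive_mul_eq_add {φ : A →L[ℝ] E} {L : A → E} (hL1 : L 1 = 0)
    (hL : ∀ x ∈ ball (1 : A) 1,
      HasFDerivAt L (φ.comp ((ContinuousLinearMap.mul ℝ A).flip (Ring.inverse x))) x)
    {x y : A} (hx : ‖x - 1‖ < 1 / 4) (hy : ‖y - 1‖ < 1 / 4) : L (x * y) = L x + L y := by
  have hsub : ∀ z ∈ ball (1 : A) (1 / 4), HasFDerivAt (fun z => L (z * y) - L z) (0 : A →L[ℝ] E) z := by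
    intro z hz
    rw [mem_ball_iff_norm] at hz
    have hyu : IsUnit y := by
      have := isUnit_one_sub_of_norm_lt_one (x := 1 - y) (by rw [norm_sub_rev]; linarith)
      rwa [sub_sub_cancel] at this
    have hzu : IsUnit z := by
      have := isUnit_one_sub_of_norm_lt_one (x := 1 - z) (by rw [norm_sub_rev]; linarith)
      rwa [sub_sub_cancel] at this
    have h1 := (hL (z * y) (mem_ball_iff_norm.2 (norm_mul_sub_one_lt_one hz hy))).comp z
      ((ContinuousLinearMap.mul ℝ A).flip y).hasFDerivAt
    have h2 := hL z (mem_ball_iff_norm.2 (by linarith))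
    refine (h1.sub h2).congr_fderiv ?_
    ext h
    obtain ⟨u, rfl⟩ := hyu
    obtain ⟨v, rfl⟩ := hzu
    rw [← Units.val_mul, Ring.inverse_unit, Ring.inverse_unit]
    simp [mul_assoc]
  have hconst := (convex_ball (1 : A) (1 / 4)).is_const_of_fderivWithin_eq_zero (𝕜 := ℝ)
    (fun z hz => (hsub z hz).differentiableAt.differentiableWithinAt)
    (fun z hz => ((hsub z hz).hasFDerivWithinAt.fderivWithin
      (isOpen_ball.uniqueDiffWithinAt hz)))
    (mem_ball_iff_norm.2 hx) (mem_ball_self (by norm_num))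
  simp only [one_mul, hL1, sub_zero] at hconst
  rw [← hconst]
  abel

end Primitive

section Unitary

variable {A E : Type*} [CStarAlgebra A]

theorem norm_mul_star_sub_one {x u : A} (hu : u ∈ unitary A) : ‖x * star u - 1‖ = ‖x - u‖ := by
  rw [← Unitary.mul_star_self_of_mem hu, ← sub_mul,
    CStarRing.norm_mul_mem_unitary _ (Unitary.star_mem hu)]

theorem apply_mul_star_add [AddCommGroup E] {L : A → E}
    (hmul : ∀ x y : A, ‖x - 1‖ < 1 / 4 → ‖y - 1‖ < 1 / 4 → L (x * y) = L x + L y)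
    {u x z : A} (hu : u ∈ unitary A) (hx : x ∈ unitary A) (hxu : ‖x - u‖ < 1 / 4)
    (hzx : ‖z - x‖ < 1 / 4) :
    L (z * star x) + L (x * star u) = L (z * star u) := by
  rw [← hmul _ _ (by rwa [norm_mul_star_sub_one hx]) (by rwa [norm_mul_star_sub_one hu]),
    mul_assoc, ← mul_assoc (star x), Unitary.star_mul_self_of_mem hx, one_mul]

/-- Two nearby discrete paths of unitaries with the same endpoints have the same total
logarithmic increment. -/
theorem sum_mul_star_eq_of_close [AddCommGroup E] {L : A → E}
    (hmul : ∀ x y : A, ‖x - 1‖ < 1 / 4 → ‖y - 1‖ < 1 / 4 → L (x * y) = L x + L y)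
    {a b : ℕ → A} {N : ℕ} (ha : ∀ i ≤ N, a i ∈ unitary A) (hb : ∀ i ≤ N, b i ∈ unitary A)
    (hab : ∀ i ≤ N, ‖b i - a i‖ < 1 / 4) (haa : ∀ i < N, ‖a (i + 1) - a i‖ < 1 / 4)
    (hbb : ∀ i < N, ‖b (i + 1) - b i‖ < 1 / 4) (h0 : a 0 = b 0) (hN : a N = b N) :
    ∑ i ∈ Finset.range N, L (a (i + 1) * star (a i)) =
      ∑ i ∈ Finset.range N, L (b (i + 1) * star (b i)) := by
  rw [← sub_eq_zero, ← Finset.sum_sub_distrib]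
  calc _ = ∑ i ∈ Finset.range N, (L (b i * star (a i)) - L (b (i + 1) * star (a (i + 1)))) := by
        refine Finset.sum_congr rfl fun i hi => ?_
        have hi := Finset.mem_range.1 hi
        have h1 := apply_mul_star_add hmul (ha i hi.le) (hb i hi.le) (hab i hi.le) (hbb i hi)
        have h2 := apply_mul_star_add hmul (ha i hi.le) (ha (i + 1) hi) (haa i hi) (hab (i + 1) hi)
        rw [sub_eq_sub_iff_add_eq_add, add_comm, h2, ← h1, add_comm]
    _ = 0 := by
        rw [Finset.sum_range_sub', h0, hN, Unitary.mul_star_self_of_mem (hb 0 (Nat.zero_le _)),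
          Unitary.mul_star_self_of_mem (hb N le_rfl), sub_self]

variable [NormedAddCommGroup E] [NormedSpace ℝ E]

theorem integral_trace_mul_star_eq_primitive [CompleteSpace E] {φ : A →L[ℝ] E} {L : A → E}
    (hL1 : L 1 = 0)
    (hL : ∀ x ∈ ball (1 : A) 1,
      HasFDerivAt L (φ.comp ((ContinuousLinearMap.mul ℝ A).flip (Ring.inverse x))) x)
    {ξ d : ℝ → A} {s : Set ℝ} (hs : s.Finite) {a b : ℝ} (hle : a ≤ b)
    (hcont : ContinuousOn ξ (Icc a b)) (hmem : ∀ t ∈ Icc a b, ξ t ∈ unitary A)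
    (hd : ∀ t ∈ Icc a b \ s, HasDerivAt ξ (d t) t)
    (hint : IntervalIntegrable (fun t => φ (d t * star (ξ t))) volume a b)
    (hclose : ∀ t ∈ Icc a b, ‖ξ t - ξ a‖ < 1 / 4) :
    ∫ t in a..b, φ (d t * star (ξ t)) = L (ξ b * star (ξ a)) := by
  have ha : ξ a ∈ unitary A := hmem a (left_mem_Icc.2 hle)
  have hball : ∀ t ∈ Icc a b, ξ t * star (ξ a) ∈ ball (1 : A) 1 := fun t ht => by
    rw [mem_ball_iff_norm, norm_mul_star_sub_one ha]
    linarith [hclose t ht]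
  rw [integral_eq_of_hasDerivAt_off_countable_of_le (fun t => L (ξ t * star (ξ a))) _ hle
    hs.countable ?_ ?_ hint]
  · rw [Unitary.mul_star_self_of_mem ha, hL1, sub_zero]
  · exact ContinuousOn.comp (t := ball (1 : A) 1)
      (fun x hx => (hL x hx).continuousAt.continuousWithinAt)
      (hcont.mul continuousOn_const) hball
  · rintro t ⟨ht, hts⟩
    have ht' := Ioo_subset_Icc_self ht
    have h1 := (hL _ (hball t ht')).comp_hasDerivAt t ((hd t ⟨ht', hts⟩).mul_const (star (ξ a)))
    refine h1.congr_deriv ?_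
    have hinv : Ring.inverse (ξ t * star (ξ a)) = ξ a * star (ξ t) := by
      let U : unitary A := ⟨ξ t, hmem t ht'⟩ * star ⟨ξ a, ha⟩
      have := Ring.inverse_unit (Unitary.toUnits U)
      simpa [U, ← Unitary.star_eq_inv] using this
    simp only [ContinuousLinearMap.comp_apply, ContinuousLinearMap.flip_apply,
      ContinuousLinearMap.mul_apply', hinv]
    rw [mul_assoc, ← mul_assoc (star (ξ a)), Unitary.star_mul_self_of_mem ha, one_mul]

theorem integral_trace_mul_star_eq_sum [CompleteSpace E] {φ : A →L[ℝ] E} {L : A → E}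
    (hL1 : L 1 = 0)
    (hL : ∀ x ∈ ball (1 : A) 1,
      HasFDerivAt L (φ.comp ((ContinuousLinearMap.mul ℝ A).flip (Ring.inverse x))) x)
    {ξ d : ℝ → A} {s : Set ℝ} (hs : s.Finite)
    (hcont : ContinuousOn ξ (Icc 0 1)) (hmem : ∀ t ∈ Icc (0 : ℝ) 1, ξ t ∈ unitary A)
    (hd : ∀ t ∈ Icc (0 : ℝ) 1 \ s, HasDerivAt ξ (d t) t)
    (hint : IntervalIntegrable (fun t => φ (d t * star (ξ t))) volume 0 1)
    {N : ℕ} (hN : 0 < N)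
    (hclose : ∀ t ∈ Icc (0 : ℝ) 1, ∀ t' ∈ Icc (0 : ℝ) 1, |t - t'| ≤ 1 / N → ‖ξ t - ξ t'‖ < 1 / 4) :
    ∫ t in (0 : ℝ)..1, φ (d t * star (ξ t)) =
      ∑ i ∈ Finset.range N, L (ξ (((i + 1 : ℕ) : ℝ) / N) * star (ξ ((i : ℝ) / N))) := by
  have hN' : (0 : ℝ) < N := Nat.cast_pos.2 hN
  have hstep : ∀ i : ℕ, ((i : ℝ) / N) ≤ ((i + 1 : ℕ) : ℝ) / N := fun i => by
    gcongr
    exact Nat.le_succ i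
  have hsub : ∀ i < N, Icc ((i : ℝ) / N) (((i + 1 : ℕ) : ℝ) / N) ⊆ Icc 0 1 := fun i hi =>
    Icc_subset_Icc (by positivity) ((div_le_one hN').2 (by exact_mod_cast hi))
  have hint' : ∀ i < N, IntervalIntegrable (fun t => φ (d t * star (ξ t))) volume
      ((i : ℝ) / N) (((i + 1 : ℕ) : ℝ) / N) := fun i hi => hint.mono_set (by
    rw [uIcc_of_le (hstep i), uIcc_of_le zero_le_one]
    exact hsub i hi)
  have hsum := intervalIntegral.sum_integral_adjacent_intervals (μ := volume)
    (a := fun i : ℕ => (i : ℝ) / N) hint'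
  simp only [Nat.cast_zero, zero_div, div_self hN'.ne'] at hsum
  rw [← hsum]
  refine Finset.sum_congr rfl fun i hi => ?_
  have hi := Finset.mem_range.1 hi
  refine integral_trace_mul_star_eq_primitive hL1 hL hs (hstep i) (hcont.mono (hsub i hi))
    (fun t ht => hmem t (hsub i hi ht)) (fun t ht => hd t ⟨hsub i hi ht.1, ht.2⟩) (hint' i hi)
    fun t ht => hclose t (hsub i hi ht) _ (hsub i hi (left_mem_Icc.2 (hstep i))) ?_
  rw [abs_of_nonneg (sub_nonneg.2 ht.1)]
  have h2 := ht.2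
  rw [Nat.cast_succ, add_div] at h2
  linarith

/-- Homotopy invariance of `∫ φ (ξ' ξ*)` for a bounded real-linear trace `φ`. -/
theorem integral_trace_mul_star_eq_of_homotopy [CompleteSpace E] (φ : A →L[ℝ] E)
    (hφ : ∀ x y, φ (x * y) = φ (y * x))
    {ξ₀ ξ₁ d₀ d₁ : ℝ → A} {s₀ s₁ : Set ℝ} (hs₀ : s₀.Finite) (hs₁ : s₁.Finite)
    (hd₀ : ∀ t ∈ Icc (0 : ℝ) 1 \ s₀, HasDerivAt ξ₀ (d₀ t) t)
    (hd₁ : ∀ t ∈ Icc (0 : ℝ) 1 \ s₁, HasDerivAt ξ₁ (d₁ t) t)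
    (hcont₀ : ContinuousOn ξ₀ (Icc 0 1)) (hcont₁ : ContinuousOn ξ₁ (Icc 0 1))
    (hint₀ : IntervalIntegrable (fun t => φ (d₀ t * star (ξ₀ t))) volume 0 1)
    (hint₁ : IntervalIntegrable (fun t => φ (d₁ t * star (ξ₁ t))) volume 0 1)
    {F : ℝ → ℝ → A}
    (hFcont : ContinuousOn (fun q : ℝ × ℝ => F q.1 q.2) (Icc 0 1 ×ˢ Icc 0 1))
    (hF0 : ∀ t ∈ Icc (0 : ℝ) 1, F 0 t = ξ₀ t)
    (hF1 : ∀ t ∈ Icc (0 : ℝ) 1, F 1 t = ξ₁ t)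
    (hFstart : ∀ s ∈ Icc (0 : ℝ) 1, F s 0 = F 0 0)
    (hFend : ∀ s ∈ Icc (0 : ℝ) 1, F s 1 = F 0 1)
    (hFmem : ∀ s ∈ Icc (0 : ℝ) 1, ∀ t ∈ Icc (0 : ℝ) 1, F s t ∈ unitary A) :
    ∫ t in (0 : ℝ)..1, φ (d₀ t * star (ξ₀ t)) = ∫ t in (0 : ℝ)..1, φ (d₁ t * star (ξ₁ t)) := by
  obtain ⟨L, hL1, hL⟩ := exists_hasFDerivAt_trace_mul_inverse φ hφ
  have h0 : (0 : ℝ) ∈ Icc (0 : ℝ) 1 := left_mem_Icc.2 zero_le_one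
  have h1 : (1 : ℝ) ∈ Icc (0 : ℝ) 1 := right_mem_Icc.2 zero_le_one
  obtain ⟨δ, hδ, hunif⟩ := Metric.uniformContinuousOn_iff.1
    ((isCompact_Icc.prod isCompact_Icc).uniformContinuousOn_of_continuous hFcont) (1 / 4)
    (by norm_num)
  obtain ⟨n, hn⟩ := exists_nat_one_div_lt hδ
  set N : ℕ := n + 1 with hNdef
  have hNpos : (0 : ℝ) < N := by positivity
  have hn : 1 / (N : ℝ) < δ := by simpa [hNdef] using hn
  have hclose : ∀ s ∈ Icc (0 : ℝ) 1, ∀ s' ∈ Icc (0 : ℝ) 1, ∀ t ∈ Icc (0 : ℝ) 1,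
      ∀ t' ∈ Icc (0 : ℝ) 1, |s - s'| ≤ 1 / N → |t - t'| ≤ 1 / N → ‖F s t - F s' t'‖ < 1 / 4 := by
    intro s hs s' hs' t ht t' ht' hss htt
    rw [← dist_eq_norm]
    exact hunif (s, t) ⟨hs, ht⟩ (s', t') ⟨hs', ht'⟩
      (max_lt (hss.trans_lt hn) (htt.trans_lt hn))
  have hgrid : ∀ i ≤ N, ((i : ℝ) / N) ∈ Icc (0 : ℝ) 1 := fun i hi =>
    ⟨by positivity, (div_le_one hNpos).2 (by exact_mod_cast hi)⟩
  have hstep : ∀ i : ℕ, |((i + 1 : ℕ) : ℝ) / N - (i : ℝ) / N| ≤ 1 / N := fun i => by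
    rw [← sub_div, Nat.cast_succ, add_sub_cancel_left, abs_of_nonneg (by positivity)]
  have hzero : ∀ x : ℝ, |x - x| ≤ 1 / N := fun x => by
    rw [sub_self, abs_zero]; positivity
  let S : ℝ → E := fun s =>
    ∑ i ∈ Finset.range N, L (F s (((i + 1 : ℕ) : ℝ) / N) * star (F s ((i : ℝ) / N)))
  have hSstep : ∀ j < N, S ((j : ℝ) / N) = S (((j + 1 : ℕ) : ℝ) / N) := by
    intro j hj
    have hj0 := hgrid j hj.le
    have hj1 := hgrid (j + 1) hj
    refine sum_mul_star_eq_of_close (a := fun i : ℕ => F ((j : ℝ) / N) ((i : ℝ) / N))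
      (b := fun i : ℕ => F (((j + 1 : ℕ) : ℝ) / N) ((i : ℝ) / N))
      (fun x y hx hy => primitive_mul_eq_add hL1 hL hx hy)
      (fun i hi => hFmem _ hj0 _ (hgrid i hi)) (fun i hi => hFmem _ hj1 _ (hgrid i hi))
      (fun i hi => hclose _ hj1 _ hj0 _ (hgrid i hi) _ (hgrid i hi) (hstep j) (hzero _))
      (fun i hi => hclose _ hj0 _ hj0 _ (hgrid _ hi) _ (hgrid i hi.le) (hzero _) (hstep i))
      (fun i hi => hclose _ hj1 _ hj1 _ (hgrid _ hi) _ (hgrid i hi.le) (hzero _) (hstep i)) ?_ ?_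
    · simp only [Nat.cast_zero, zero_div]
      rw [hFstart _ hj0, hFstart _ hj1]
    · simp only [div_self hNpos.ne']
      rw [hFend _ hj0, hFend _ hj1]
  have hSall : ∀ j ≤ N, S 0 = S ((j : ℝ) / N) := by
    intro j
    induction j with
    | zero => simp
    | succ j ih => exact fun hj => (ih (Nat.le_of_succ_le hj)).trans (hSstep j hj)
  have hS : S 0 = S 1 := by simpa only [div_self hNpos.ne'] using hSall N le_rfl
  have hend : ∀ {s : ℝ} {ξ d : ℝ → A} {r : Set ℝ}, s ∈ Icc (0 : ℝ) 1 → r.Finite →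
      ContinuousOn ξ (Icc 0 1) → (∀ t ∈ Icc (0 : ℝ) 1 \ r, HasDerivAt ξ (d t) t) →
      IntervalIntegrable (fun t => φ (d t * star (ξ t))) volume 0 1 →
      (∀ t ∈ Icc (0 : ℝ) 1, F s t = ξ t) →
      ∫ t in (0 : ℝ)..1, φ (d t * star (ξ t)) = S s := by
    intro s ξ d r hs hr hcont hd hint hF
    rw [integral_trace_mul_star_eq_sum hL1 hL hr hcont
      (fun t ht => hF t ht ▸ hFmem s hs t ht) hd hint n.succ_pos (fun t ht t' ht' htt => by
        rw [← hF t ht, ← hF t' ht']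
        exact hclose s hs s hs t ht t' ht' (hzero s) htt)]
    refine Finset.sum_congr rfl fun i hi => ?_
    have hi := Finset.mem_range.1 hi
    rw [hF _ (hgrid (i + 1) hi), hF _ (hgrid i hi.le)]
  rw [hend h0 hs₀ hcont₀ hd₀ hint₀ hF0, hend h1 hs₁ hcont₁ hd₁ hint₁ hF1, hS]

/-- The logarithmic derivative of a path of unitaries is skew-adjoint. -/
theorem star_deriv_mul_star_eq_neg {ξ : ℝ → A} {d : A} {t : ℝ} (hd : HasDerivAt ξ d t)
    (hmem : ∀ᶠ r in nhds t, ξ r ∈ unitary A) : star (d * star (ξ t)) = -(d * star (ξ t)) := by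
  have h1 : HasDerivAt (fun r => ξ r * star (ξ r)) (d * star (ξ t) + ξ t * star d) t :=
    hd.mul hd.star
  have h2 : HasDerivAt (fun r => ξ r * star (ξ r)) 0 t :=
    (hasDerivAt_const t (1 : A)).congr_of_eventuallyEq
      (hmem.mono fun r hr => Unitary.mul_star_self_of_mem hr)
  rw [star_mul, star_star, eq_neg_iff_add_eq_zero, add_comm]
  exact h1.unique h2

/-- A tracial map on the self-adjoint part extends to the bounded real-linear trace
`x ↦ τ (Re ((2πi)⁻¹ x))`, and this computes the integrand of the pre-determinant. -/
theorem exists_trace_eq_of_skewAdjoint (τ : A →L[ℝ] E)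
    (htracial : ∀ a : A, τ (a * star a) = τ (star a * a)) :
    ∃ φ : A →L[ℝ] E, (∀ x y, φ (x * y) = φ (y * x)) ∧
      ∀ x : A, star x = -x → φ x = τ (((2 * Real.pi * Complex.I : ℂ))⁻¹ • x) := by
  set c : ℂ := (2 * Real.pi * Complex.I : ℂ)⁻¹ with hc
  have hcstar : star c = -c := by
    simp [hc]
  let m : A →L[ℝ] A := (ContinuousLinearMap.lsmul ℝ ℂ c : A →L[ℝ] A)
  let R : A →L[ℝ] E := (1 / 2 : ℝ) • (τ + τ.comp (starL' ℝ : A ≃L[ℝ] A).toContinuousLinearMap)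
  have hR : ∀ x, R x = (1 / 2 : ℝ) • (τ x + τ (star x)) := fun x => rfl
  have hRtr : ∀ x y, R (x * y) = R (y * x) := by
    intro x y
    have h1 := htracial (x + star y)
    simp only [star_add, star_star, add_mul, mul_add, map_add] at h1
    have h2 := htracial x
    have h3 := htracial y
    rw [hR, hR, star_mul, star_mul]
    congr 1
    rw [h2, ← h3] at h1
    rw [← sub_eq_zero] at h1 ⊢
    rw [← h1]
    abel
  refine ⟨R.comp m, fun x y => ?_, fun x hx => ?_⟩
  · change R (c • (x * y)) = R (c • (y * x))
    rw [← smul_mul_assoc, hRtr, mul_smul_comm]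
  · change R (c • x) = _
    rw [hR, star_smul, hcstar, hx, neg_smul_neg, ← two_smul ℝ, smul_smul]
    norm_num

theorem trace_eqOn_deriv_mul_star {φ τ : A →L[ℝ] E}
    (hφ : ∀ x : A, star x = -x → φ x = τ (((2 * Real.pi * Complex.I : ℂ))⁻¹ • x))
    {ξ d : ℝ → A} {s : Set ℝ} (hs : s.Finite)
    (hmem : ∀ t ∈ Icc (0 : ℝ) 1, ξ t ∈ unitary A)
    (hd : ∀ t ∈ Icc (0 : ℝ) 1 \ s, HasDerivAt ξ (d t) t) :
    (fun t => τ (((2 * Real.pi * Complex.I : ℂ))⁻¹ • (d t * star (ξ t))))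
      =ᵐ[volume.restrict (uIoc 0 1)] fun t => φ (d t * star (ξ t)) := by
  rw [uIoc_of_le zero_le_one, ← restrict_Ioo_eq_restrict_Ioc]
  filter_upwards [ae_restrict_mem measurableSet_Ioo,
    ae_restrict_of_ae (hs.countable.ae_notMem volume)] with t ht hts
  refine (hφ _ (star_deriv_mul_star_eq_neg (hd t ⟨Ioo_subset_Icc_self ht, hts⟩) ?_)).symm
  filter_upwards [isOpen_Ioo.mem_nhds ht] with r hr using hmem r (Ioo_subset_Icc_self hr)

end Unitary


/-- The pre-determinant `Δ̃_τ(ξ) = ∫₀¹ τ((2πi)⁻¹ ξ'(t) ξ(t)⁻¹) dt`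
depends only on the homotopy class rel endpoints: if `ξ₀, ξ₁` are piecewise smooth paths
of unitaries from `1` with the same endpoint which are homotopic with fixed endpoints
through the unitary group, then `Δ̃_τ(ξ₀) = Δ̃_τ(ξ₁)`. -/
theorem predeterminant_homotopy_invariant {A E : Type*} [CStarAlgebra A]
    [NormedAddCommGroup E] [NormedSpace ℝ E] [CompleteSpace E]
    (τ : A →L[ℝ] E) (htracial : ∀ a : A, τ (a * star a) = τ (star a * a))
    (ξ₀ ξ₁ d₀ d₁ : ℝ → A) (s₀ s₁ : Set ℝ) (hs₀ : s₀.Finite) (hs₁ : s₁.Finite)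
    (hcont₀ : ContinuousOn ξ₀ (Set.Icc 0 1)) (hcont₁ : ContinuousOn ξ₁ (Set.Icc 0 1))
    (hmem₀ : ∀ t ∈ Set.Icc (0 : ℝ) 1, ξ₀ t ∈ unitary A)
    (hmem₁ : ∀ t ∈ Set.Icc (0 : ℝ) 1, ξ₁ t ∈ unitary A)
    (hstart₀ : ξ₀ 0 = 1) (hstart₁ : ξ₁ 0 = 1) (hend : ξ₀ 1 = ξ₁ 1)
    (hd₀ : ∀ t ∈ Set.Icc (0 : ℝ) 1 \ s₀, HasDerivAt ξ₀ (d₀ t) t)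
    (hd₁ : ∀ t ∈ Set.Icc (0 : ℝ) 1 \ s₁, HasDerivAt ξ₁ (d₁ t) t)
    (hint₀ : IntervalIntegrable
      (fun t => τ (((2 * Real.pi * Complex.I : ℂ))⁻¹ • (d₀ t * star (ξ₀ t))))
      MeasureTheory.volume 0 1)
    (hint₁ : IntervalIntegrable
      (fun t => τ (((2 * Real.pi * Complex.I : ℂ))⁻¹ • (d₁ t * star (ξ₁ t))))
      MeasureTheory.volume 0 1)
    -- homotopy with fixed endpoints through unitaries
    (F : ℝ → ℝ → A)
    (hFcont : ContinuousOn (fun q : ℝ × ℝ => F q.1 q.2) (Set.Icc 0 1 ×ˢ Set.Icc 0 1))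
    (hF0 : ∀ t ∈ Set.Icc (0 : ℝ) 1, F 0 t = ξ₀ t)
    (hF1 : ∀ t ∈ Set.Icc (0 : ℝ) 1, F 1 t = ξ₁ t)
    (hFstart : ∀ s ∈ Set.Icc (0 : ℝ) 1, F s 0 = 1)
    (hFend : ∀ s ∈ Set.Icc (0 : ℝ) 1, F s 1 = ξ₀ 1)
    (hFmem : ∀ s ∈ Set.Icc (0 : ℝ) 1, ∀ t ∈ Set.Icc (0 : ℝ) 1, F s t ∈ unitary A) :
    ∫ t in (0 : ℝ)..1, τ (((2 * Real.pi * Complex.I : ℂ))⁻¹ • (d₀ t * star (ξ₀ t)))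
      = ∫ t in (0 : ℝ)..1, τ (((2 * Real.pi * Complex.I : ℂ))⁻¹ • (d₁ t * star (ξ₁ t))) := by
  obtain ⟨φ, hφ, hφτ⟩ := exists_trace_eq_of_skewAdjoint τ htracial
  have hae₀ := trace_eqOn_deriv_mul_star hφτ hs₀ hmem₀ hd₀
  have hae₁ := trace_eqOn_deriv_mul_star hφτ hs₁ hmem₁ hd₁
  rw [intervalIntegral.integral_congr_ae_restrict hae₀,
    intervalIntegral.integral_congr_ae_restrict hae₁]
  have h0 : (0 : ℝ) ∈ Icc (0 : ℝ) 1 := left_mem_Icc.2 zero_le_one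
  exact integral_trace_mul_star_eq_of_homotopy φ hφ hs₀ hs₁ hd₀ hd₁ hcont₀ hcont₁
    (hint₀.congr_ae hae₀) (hint₁.congr_ae hae₁) hFcont hF0 hF1
    (fun s hs => by rw [hFstart s hs, hFstart 0 h0])
    (fun s hs => by rw [hFend s hs, hFend 0 h0]) hFmem
end

section
/- Let M be a type II₁ von Neumann algebra with center-valued trace Tr. For every positive contraction a ∈ Z(M) there exists a projection p ∈ M with Tr(p) = a. -/
section DescendingProjections

variable {A : Type*} [Ring A] [StarRing A] {g z : ℕ → A}

theorem mul_eq_left_of_forall_succ_mul_eq (hg : ∀ n, IsStarProjection (g n))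
    (hs : ∀ n, g (n + 1) * g n = g (n + 1)) {m n : ℕ} (h : m ≤ n) : g n * g m = g n := by
  induction n, h using Nat.le_induction with
  | base => exact (hg m).isIdempotentElem
  | succ n _ ih => rw [← hs n, mul_assoc, ih]

theorem mul_eq_right_of_forall_succ_mul_eq (hg : ∀ n, IsStarProjection (g n))
    (hs : ∀ n, g (n + 1) * g n = g (n + 1)) {m n : ℕ} (h : m ≤ n) : g m * g n = g n := by
  simpa [(hg _).isSelfAdjoint.star_eq] using
    congr(star $(mul_eq_left_of_forall_succ_mul_eq hg hs h))

theorem sub_succ_mul_sub_succ_eq_zero (hg : ∀ n, IsStarProjection (g n))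
    (hs : ∀ n, g (n + 1) * g n = g (n + 1)) {m n : ℕ} (h : m ≠ n) :
    (g m - g (m + 1)) * (g n - g (n + 1)) = 0 := by
  rcases lt_or_gt_of_ne h with h | h
  · simp only [sub_mul, mul_sub, mul_eq_right_of_forall_succ_mul_eq hg hs h,
      mul_eq_right_of_forall_succ_mul_eq hg hs (show m ≤ n by omega),
      mul_eq_right_of_forall_succ_mul_eq hg hs (show m ≤ n + 1 by omega),
      mul_eq_right_of_forall_succ_mul_eq hg hs (show m + 1 ≤ n + 1 by omega), sub_self]
  · simp only [sub_mul, mul_sub, mul_eq_left_of_forall_succ_mul_eq hg hs h,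
      mul_eq_left_of_forall_succ_mul_eq hg hs (show n ≤ m by omega),
      mul_eq_left_of_forall_succ_mul_eq hg hs (show n ≤ m + 1 by omega),
      mul_eq_left_of_forall_succ_mul_eq hg hs (show n + 1 ≤ m + 1 by omega), sub_self]

theorem isStarProjection_sub_succ (hg : ∀ n, IsStarProjection (g n))
    (hs : ∀ n, g (n + 1) * g n = g (n + 1)) (n : ℕ) : IsStarProjection (g n - g (n + 1)) :=
  (hg (n + 1)).sub_of_mul_eq_left (hg n) (hs n)

theorem central_mul_sub_succ_mul_eq_zero (hg : ∀ n, IsStarProjection (g n))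
    (hs : ∀ n, g (n + 1) * g n = g (n + 1)) (hzc : ∀ n, z n ∈ Set.center A) {m n : ℕ}
    (h : m ≠ n) :
    z m * (g m - g (m + 1)) * (z n * (g n - g (n + 1))) = 0 := by
  rw [mul_assoc, ← mul_assoc _ (z n), Semigroup.mem_center_iff.1 (hzc n), mul_assoc,
    sub_succ_mul_sub_succ_eq_zero hg hs h, mul_zero, mul_zero]

theorem isStarProjection_sum_central_mul_sub_succ (hg : ∀ n, IsStarProjection (g n))
    (hs : ∀ n, g (n + 1) * g n = g (n + 1)) (hzc : ∀ n, z n ∈ Set.center A)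
    (hz : ∀ n, IsStarProjection (z n)) (n : ℕ) :
    IsStarProjection (∑ k ∈ Finset.range n, z k * (g k - g (k + 1))) := by
  induction n with
  | zero => simp
  | succ n ih =>
    rw [Finset.sum_range_succ]
    refine ih.add ((hz n).mul (isStarProjection_sub_succ hg hs n)
      (Semigroup.mem_center_iff.1 (hzc n) _).symm) ?_
    rw [Finset.sum_mul]
    exact Finset.sum_eq_zero fun k hk =>
      central_mul_sub_succ_mul_eq_zero hg hs hzc (Finset.mem_range.1 hk).ne

theorem isStarProjection_sum_central_mul_sub_succ_add (hg : ∀ n, IsStarProjection (g n))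
    (hs : ∀ n, g (n + 1) * g n = g (n + 1)) (hzc : ∀ n, z n ∈ Set.center A)
    (hz : ∀ n, IsStarProjection (z n)) (n : ℕ) :
    IsStarProjection (∑ k ∈ Finset.range n, z k * (g k - g (k + 1)) + g n) := by
  refine (isStarProjection_sum_central_mul_sub_succ hg hs hzc hz n).add (hg n) ?_
  rw [Finset.sum_mul]
  refine Finset.sum_eq_zero fun k hk => ?_
  have hk := Finset.mem_range.1 hk
  rw [mul_assoc, sub_mul, mul_eq_right_of_forall_succ_mul_eq hg hs hk,
    mul_eq_right_of_forall_succ_mul_eq hg hs hk.le, sub_self, mul_zero]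

theorem sum_central_mul_sub_succ_add_mul (hg0 : g 0 = 1) (hg : ∀ n, IsStarProjection (g n))
    (hs : ∀ n, g (n + 1) * g n = g (n + 1)) (hzc : ∀ n, z n ∈ Set.center A)
    (hz : ∀ n, IsStarProjection (z n)) (n m : ℕ) :
    (∑ k ∈ Finset.range n, z k * (g k - g (k + 1)) + g n) * (z m * (g m - g (m + 1))) =
      z m * (g m - g (m + 1)) := by
  induction n with
  | zero => simp [hg0]
  | succ n ih =>
    have hzero : (1 - z n) * (g n - g (n + 1)) * (z m * (g m - g (m + 1))) = 0 := by
      rw [mul_assoc, ← mul_assoc _ (z m), Semigroup.mem_center_iff.1 (hzc m), mul_assoc (z m)]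
      rcases eq_or_ne n m with rfl | h
      · rw [← mul_assoc, (hz n).one_sub_mul_self, zero_mul]
      · rw [sub_succ_mul_sub_succ_eq_zero hg hs h, mul_zero, mul_zero]
    have hstep : ∑ k ∈ Finset.range (n + 1), z k * (g k - g (k + 1)) + g (n + 1) =
        (∑ k ∈ Finset.range n, z k * (g k - g (k + 1)) + g n) -
          (1 - z n) * (g n - g (n + 1)) := by
      rw [Finset.sum_range_succ, sub_mul, one_mul]
      abel
    rw [hstep, sub_mul, ih, hzero, sub_zero]

/-- Iterated halving of the unit. -/
theorem exists_halving_sequence [Algebra ℂ A] (Tr : A →ₗ[ℂ] A)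
    (htracial : ∀ a b, Tr (a * b) = Tr (b * a))
    (hhalving : ∀ p : A, IsSelfAdjoint p → IsIdempotentElem p → p ≠ 0 →
      ∃ q : A, IsSelfAdjoint q ∧ IsIdempotentElem q ∧ q * p = q ∧
        ∃ v, star v * v = q ∧ v * star v = p - q) :
    ∃ g : ℕ → A, g 0 = 1 ∧ (∀ n, IsStarProjection (g n)) ∧
      (∀ n, g (n + 1) * g n = g (n + 1)) ∧
      ∀ n, ∀ z ∈ Set.center A, Tr (z * g n) = (2⁻¹ : ℂ) ^ n • Tr z := by
  have step (p : {p : A // IsStarProjection p}) : ∃ q : {q : A // IsStarProjection q},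
      q.1 * p.1 = q.1 ∧ ∀ z ∈ Set.center A, Tr (z * q) = (2⁻¹ : ℂ) • Tr (z * p) := by
    obtain ⟨p, hp⟩ := p
    rcases eq_or_ne p 0 with rfl | h0
    · exact ⟨⟨0, .zero _⟩, by simp, by simp⟩
    obtain ⟨q, hq, hq', hqp, v, hv, hv'⟩ := hhalving p hp.isSelfAdjoint hp.isIdempotentElem h0
    refine ⟨⟨q, hq', hq⟩, hqp, fun z hz => ?_⟩
    have h : Tr (z * q) = Tr (z * (p - q)) := by
      rw [← hv, ← mul_assoc, htracial, ← mul_assoc, Semigroup.mem_center_iff.1 hz, mul_assoc, hv',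
        hv]
    rw [mul_sub, map_sub, eq_sub_iff_add_eq, ← two_smul ℂ] at h
    rw [← h, smul_smul]
    norm_num
  choose F hF hF' using step
  let g (n : ℕ) : {p : A // IsStarProjection p} := F^[n] ⟨1, .one _⟩
  have hg (n : ℕ) : g (n + 1) = F (g n) := Function.iterate_succ_apply' F n _
  refine ⟨fun n => (g n).1, rfl, fun n => (g n).2, fun n => ?_, fun n z hz => ?_⟩
  · simp only [hg, hF]
  · induction n with
    | zero => simp [g]
    | succ n ih => simp only [hg, hF' _ z hz, ih, smul_smul, pow_succ']

end DescendingProjections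

open ContinuousLinearMap in
/-- The projection onto the closed span of the ranges of a family of operators. -/
theorem ContinuousLinearMap.exists_isStarProjection_closure_iSup_range {H : Type*}
    [NormedAddCommGroup H] [InnerProductSpace ℂ H] [CompleteSpace H] {ι : Type*}
    (x : ι → H →L[ℂ] H) :
    ∃ p : H →L[ℂ] H, IsStarProjection p ∧ (∀ i, p * x i = x i) ∧
      (∀ y : H →L[ℂ] H, (∀ i, y * x i = 0) → y * p = 0) ∧
      ∀ u, (∀ i, Commute u (x i)) → (∀ i, Commute (star u) (x i)) → Commute u p := by
  set K : Submodule ℂ H := (⨆ i, (x i).range).topologicalClosure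
  have : CompleteSpace K := (Submodule.isClosed_topologicalClosure _).completeSpace_coe
  have hp : IsStarProjection K.starProjection := isStarProjection_starProjection
  have hx (i) : K.starProjection * x i = x i := by
    ext v
    refine Submodule.starProjection_eq_self_iff.2 (Submodule.le_topologicalClosure _ ?_)
    exact Submodule.mem_iSup_of_mem i ⟨v, rfl⟩
  have hy (y : H →L[ℂ] H) (h : ∀ i, y * x i = 0) : y * K.starProjection = 0 := by
    have hle : K ≤ y.ker := by
      refine Submodule.topologicalClosure_minimal _ (iSup_le fun i => ?_) y.isClosed_ker
      rintro _ ⟨v, rfl⟩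
      exact congr($(h i) v)
    ext v
    exact hle (K.starProjection_apply_mem v)
  have key (u : H →L[ℂ] H) (h : ∀ i, Commute u (x i)) :
      u * K.starProjection = K.starProjection * (u * K.starProjection) := by
    have := hy ((1 - K.starProjection) * u) fun i => by
      rw [mul_assoc, (h i).eq, ← mul_assoc, sub_mul, hx, one_mul, sub_self, zero_mul]
    rwa [sub_mul, one_mul, sub_mul, sub_eq_zero, mul_assoc] at this
  refine ⟨K.starProjection, hp, hx, hy, fun u h h' => ?_⟩
  have h1 := congr(star $(key (star u) h'))
  simp only [star_mul, star_star, hp.isSelfAdjoint.star_eq] at h1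
  rw [Commute, SemiconjBy, h1, key u h, mul_assoc]

namespace VonNeumannAlgebra

variable {H : Type*} [NormedAddCommGroup H] [InnerProductSpace ℂ H] [CompleteSpace H]
  (M : VonNeumannAlgebra H)

theorem mem_of_forall_commute {x : H →L[ℂ] H} (h : ∀ u ∈ M.commutant, Commute u x) :
    x ∈ M := by
  rw [← M.commutant_commutant, mem_commutant_iff]
  exact h

theorem exists_isStarProjection_closure_iSup_range {ι : Type*} (x : ι → M.toStarSubalgebra) :
    ∃ p : M.toStarSubalgebra, IsStarProjection p ∧ (∀ i, p * x i = x i) ∧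
      ∀ y : M.toStarSubalgebra, (∀ i, y * x i = 0) → y * p = 0 := by
  obtain ⟨p, hp, hx, hy, hu⟩ :=
    ContinuousLinearMap.exists_isStarProjection_closure_iSup_range
      fun i => (x i : H →L[ℂ] H)
  have hpM : p ∈ M := M.mem_of_forall_commute fun u hu' =>
    hu u (fun i => (mem_commutant_iff.1 hu' _ (x i).2).symm)
      fun i => (mem_commutant_iff.1 (star_mem hu') _ (x i).2).symm
  refine ⟨⟨p, hpM⟩, ⟨Subtype.ext hp.1, Subtype.ext hp.2⟩, fun i => Subtype.ext (hx i),
    fun y h => Subtype.ext (hy y fun i => congr(($(h i) : H →L[ℂ] H)))⟩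

/-- The leading binary digit of a central positive contraction. -/
theorem exists_central_isStarProjection_sub_mem_Icc {a : M.toStarSubalgebra}
    (ha : a ∈ Set.center M.toStarSubalgebra) (h0 : 0 ≤ (a : H →L[ℂ] H))
    (h1 : (a : H →L[ℂ] H) ≤ 1) :
    ∃ z ∈ Set.center M.toStarSubalgebra, IsStarProjection z ∧
      0 ≤ ((2 * a - z : M.toStarSubalgebra) : H →L[ℂ] H) ∧
      ((2 * a - z : M.toStarSubalgebra) : H →L[ℂ] H) ≤ 1 := by
  set c : H →L[ℂ] H := 2 * a - 1 with hc
  have hcsa : IsSelfAdjoint c := by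
    have := (IsSelfAdjoint.of_nonneg h0)
    rw [hc, two_mul]
    exact (this.add this).sub (.one _)
  obtain ⟨z, hz, hx, hy, hu⟩ :=
    ContinuousLinearMap.exists_isStarProjection_closure_iSup_range
      fun _ : Unit => c⁺
  have hcomm {u : H →L[ℂ] H} (h : Commute u a) (h' : Commute (star u) a) : Commute u z := by
    have aux {u : H →L[ℂ] H} (h : Commute u a) : Commute u c⁺ := by
      have : Commute c u := by
        rw [hc, two_mul]
        exact ((h.add_right h).sub_right (.one_right _)).symm
      exact (this.cfcₙ_real _).symm
    exact hu u (fun _ => aux h) fun _ => aux h'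
  have hzM : z ∈ M := M.mem_of_forall_commute fun u hu' =>
    hcomm (mem_commutant_iff.1 hu' _ a.2).symm
      (mem_commutant_iff.1 (star_mem hu') _ a.2).symm
  have haM (u : M.toStarSubalgebra) : Commute (u : H →L[ℂ] H) a :=
    congr(($((Semigroup.mem_center_iff.1 ha u)) : H →L[ℂ] H))
  have hpos : 0 ≤ c⁺ := CFC.posPart_nonneg c
  have hneg : 0 ≤ c⁻ := CFC.negPart_nonneg c
  have hdec : c = c⁺ - c⁻ := (CFC.posPart_sub_negPart c hcsa).symm
  have hzp : z * c⁺ = c⁺ := hx ()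
  have hpz : c⁺ * z = c⁺ := by
    simpa [hz.isSelfAdjoint.star_eq, (IsSelfAdjoint.of_nonneg hpos).star_eq] using congr(star $hzp)
  have hnz : c⁻ * z = 0 := hy _ fun _ => CFC.negPart_mul_posPart c
  have hzn : z * c⁻ = 0 := by
    simpa [hz.isSelfAdjoint.star_eq, (IsSelfAdjoint.of_nonneg hneg).star_eq] using congr(star $hnz)
  have hzz : z * z = z := hz.isIdempotentElem
  have hlow : 0 ≤ (1 - z) * (1 + c) * (1 - z) := by
    refine hz.one_sub.isSelfAdjoint.conjugate_nonneg ?_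
    have : 1 + c = a + a := by rw [hc, two_mul]; abel
    rw [this]
    exact add_nonneg h0 h0
  have hupp : 0 ≤ z * (1 - c) * z := by
    refine hz.isSelfAdjoint.conjugate_nonneg ?_
    have : 1 - c = (1 - a) + (1 - a) := by rw [hc, two_mul]; abel
    rw [this]
    exact add_nonneg (sub_nonneg.2 h1) (sub_nonneg.2 h1)
  have hzc : z * c = c⁺ := by conv_lhs => rw [hdec, mul_sub, hzp, hzn, sub_zero]
  have hcz : c * z = c⁺ := by conv_lhs => rw [hdec, sub_mul, hpz, hnz, sub_zero]
  have hn : c⁻ = c⁺ - c := by nth_rewrite 3 [hdec]; abel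
  have hlow' : (1 - z) * (1 + c) * (1 - z) = 1 - z - c⁻ := by
    simp only [hn, mul_add, add_mul, mul_sub, sub_mul, mul_one, one_mul, hzc, hcz, hpz, hzz]
    abel
  have hupp' : z * (1 - c) * z = z - c⁺ := by
    simp only [mul_sub, sub_mul, mul_one, hzc, hpz, hzz]
  have hval : (2 * a - z : H →L[ℂ] H) = 1 + c - z := by rw [hc]; abel
  refine ⟨⟨z, hzM⟩, Semigroup.mem_center_iff.2 fun u =>
    Subtype.ext (hcomm (haM u) (haM (star u))), ⟨Subtype.ext hz.1, Subtype.ext hz.2⟩, ?_, ?_⟩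
  · change (0 : H →L[ℂ] H) ≤ 2 * a - z
    have : 1 + c - z = (1 - z - c⁻) + c⁺ := by nth_rewrite 1 [hdec]; abel
    rw [hval, this, ← hlow']
    exact add_nonneg hlow hpos
  · change (2 * a - z : H →L[ℂ] H) ≤ 1
    have : 1 - (1 + c - z) = (z - c⁺) + c⁻ := by nth_rewrite 1 [hdec]; abel
    rw [hval, ← sub_nonneg, this, ← hupp']
    exact add_nonneg hupp hneg

/-- The binary expansion of a central positive contraction, with projections as digits. -/
theorem exists_central_binary_expansion {a : M.toStarSubalgebra}
    (ha : a ∈ Set.center M.toStarSubalgebra) (h0 : 0 ≤ (a : H →L[ℂ] H))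
    (h1 : (a : H →L[ℂ] H) ≤ 1) :
    ∃ z : ℕ → M.toStarSubalgebra, (∀ n, z n ∈ Set.center M.toStarSubalgebra) ∧
      (∀ n, IsStarProjection (z n)) ∧
      ∀ n, ‖a - ∑ k ∈ Finset.range n, (2⁻¹ : ℂ) ^ (k + 1) • z k‖ ≤ 2⁻¹ ^ n := by
  let T := {x : M.toStarSubalgebra // x ∈ Set.center M.toStarSubalgebra ∧
    0 ≤ (x : H →L[ℂ] H) ∧ (x : H →L[ℂ] H) ≤ 1}
  have step (x : T) : ∃ z ∈ Set.center M.toStarSubalgebra, IsStarProjection z ∧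
      0 ≤ ((2 * x.1 - z : M.toStarSubalgebra) : H →L[ℂ] H) ∧
      ((2 * x.1 - z : M.toStarSubalgebra) : H →L[ℂ] H) ≤ 1 :=
    M.exists_central_isStarProjection_sub_mem_Icc x.2.1 x.2.2.1 x.2.2.2
  choose d hdc hd hd0 hd1 using step
  let F (x : T) : T := ⟨2 * x.1 - d x,
    (Subring.center _).sub_mem (two_mul x.1 ▸ (Subring.center _).add_mem x.2.1 x.2.1) (hdc x),
    hd0 x, hd1 x⟩
  let b (n : ℕ) : T := F^[n] ⟨a, ha, h0, h1⟩
  have hb (n : ℕ) : (b (n + 1)).1 = 2 * (b n).1 - d (b n) :=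
    congr($(Function.iterate_succ_apply' F n _).1)
  refine ⟨fun n => d (b n), fun n => hdc _, fun n => hd _, fun n => ?_⟩
  have hrem : a - ∑ k ∈ Finset.range n, (2⁻¹ : ℂ) ^ (k + 1) • d (b k) =
      (2⁻¹ : ℂ) ^ n • (b n).1 := by
    induction n with
    | zero => simp [b]
    | succ n ih =>
      rw [Finset.sum_range_succ, ← sub_sub, ih, hb, smul_sub, two_mul, ← two_smul ℂ, smul_smul,
        pow_succ, mul_assoc, inv_mul_cancel₀ two_ne_zero, mul_one]
  rw [hrem, norm_smul, norm_pow, norm_inv, RCLike.norm_ofNat]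
  refine mul_le_of_le_one_right (by positivity) ?_
  exact (CStarAlgebra.norm_le_one_iff_of_nonneg _ (b n).2.2.1).2 (b n).2.2.2

end VonNeumannAlgebra

/-- Let `M` be a type II₁ von Neumann algebra with center-valued trace
`Tr` (axioms as hypotheses; finiteness and halving of projections characterize type II₁
among finite von Neumann algebras).  Then for every positive contraction `a` in the
center `Z(M)` (positivity encoded as `a = star b * b`, contraction as `‖a‖ ≤ 1`) there
is a projection `p ∈ M` with `Tr p = a`. -/
theorem exists_projection_with_trace {H : Type*} [NormedAddCommGroup H]
    [InnerProductSpace ℂ H] [CompleteSpace H] (M : VonNeumannAlgebra H)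
    (Tr : ↥M.toStarSubalgebra →ₗ[ℂ] ↥M.toStarSubalgebra)
    (hTr_cont : Continuous Tr)
    (hTr_central : ∀ a, Tr a ∈ Set.center ↥M.toStarSubalgebra)
    (hTr_tracial : ∀ a b, Tr (a * b) = Tr (b * a))
    (hTr_pos : ∀ a, ∃ b, Tr (star a * a) = star b * b)
    (hTr_faithful : ∀ a, Tr (star a * a) = 0 → a = 0)
    (hTr_id : ∀ z ∈ Set.center ↥M.toStarSubalgebra, Tr z = z)
    (hfinite : ∀ v : ↥M.toStarSubalgebra, star v * v = 1 → v * star v = 1)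
    (hhalving : ∀ p : ↥M.toStarSubalgebra, IsSelfAdjoint p → IsIdempotentElem p → p ≠ 0 →
      ∃ q : ↥M.toStarSubalgebra, IsSelfAdjoint q ∧ IsIdempotentElem q ∧ q * p = q ∧
        ∃ v, star v * v = q ∧ v * star v = p - q)
    (a : ↥M.toStarSubalgebra) (ha_central : a ∈ Set.center ↥M.toStarSubalgebra)
    (ha_pos : ∃ b, a = star b * b) (ha_contraction : ‖a‖ ≤ 1) :
    ∃ p : ↥M.toStarSubalgebra, IsSelfAdjoint p ∧ IsIdempotentElem p ∧ Tr p = a := by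
  obtain ⟨g, hg0, hg, hs, hTrg⟩ := exists_halving_sequence Tr hTr_tracial hhalving
  have ha0 : 0 ≤ (a : H →L[ℂ] H) := by
    obtain ⟨b, rfl⟩ := ha_pos
    exact star_mul_self_nonneg (b : H →L[ℂ] H)
  obtain ⟨z, hzc, hz, hza⟩ := M.exists_central_binary_expansion ha_central ha0
    ((CStarAlgebra.norm_le_one_iff_of_nonneg _ ha0).1 ha_contraction)
  obtain ⟨p, hp, hpf, hmin⟩ := M.exists_isStarProjection_closure_iSup_range
    fun k => z k * (g k - g (k + 1))
  refine ⟨p, hp.isSelfAdjoint, hp.isIdempotentElem, ?_⟩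
  have hnonneg {x : M.toStarSubalgebra} (hx : IsStarProjection x) :
      0 ≤ (Tr x : H →L[ℂ] H) := by
    obtain ⟨b, hb⟩ := hTr_pos x
    rw [hx.isSelfAdjoint.star_eq, hx.isIdempotentElem.eq] at hb
    rw [hb]
    exact star_mul_self_nonneg (b : H →L[ℂ] H)
  have hbound (n : ℕ) : ‖Tr p - a‖ ≤ 2 * 2⁻¹ ^ n := by
    set P := ∑ k ∈ Finset.range n, z k * (g k - g (k + 1)) with hP
    have hTrP : Tr P = ∑ k ∈ Finset.range n, (2⁻¹ : ℂ) ^ (k + 1) • z k := by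
      rw [hP, map_sum]
      refine Finset.sum_congr rfl fun k _ => ?_
      rw [mul_sub, map_sub, hTrg _ _ (hzc k), hTrg _ _ (hzc k), hTr_id _ (hzc k), ← sub_smul,
        pow_succ]
      congr 1
      ring
    have hlow : IsStarProjection (p - P) :=
      (isStarProjection_sum_central_mul_sub_succ hg hs hzc hz n).sub_of_mul_eq_right hp <| by
        rw [Finset.mul_sum]
        exact Finset.sum_congr rfl fun k _ => hpf k
    have hupp : IsStarProjection (P + g n - p) := by
      refine hp.sub_of_mul_eq_right
        (isStarProjection_sum_central_mul_sub_succ_add hg hs hzc hz n) ?_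
      have := hmin (1 - (P + g n)) fun m => by
        rw [sub_mul, one_mul, sum_central_mul_sub_succ_add_mul hg0 hg hs hzc hz, sub_self]
      rw [sub_mul, one_mul, sub_eq_zero] at this
      exact this.symm
    have hTrn : Tr (g n) = (2⁻¹ : ℂ) ^ n • 1 := by
      have h1 : (1 : M.toStarSubalgebra) ∈ Set.center M.toStarSubalgebra := Set.one_mem_center
      rw [← hTr_id 1 h1, ← hTrg n 1 h1, one_mul]
    have hle : (Tr (p - P) : H →L[ℂ] H) ≤ (Tr (g n) : H →L[ℂ] H) := by
      have h : Tr (g n) = Tr (p - P) + Tr (P + g n - p) := by rw [← map_add]; congr 1; abel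
      rw [h]
      exact le_add_of_nonneg_right (hnonneg hupp)
    have hnorm : ‖Tr (p - P)‖ ≤ 2⁻¹ ^ n := by
      refine (CStarAlgebra.norm_le_norm_of_nonneg_of_le (hnonneg hlow) hle).trans ?_
      rw [hTrn]
      change ‖(2⁻¹ : ℂ) ^ n • (1 : H →L[ℂ] H)‖ ≤ _
      rw [norm_smul, norm_pow, norm_inv, RCLike.norm_ofNat]
      exact mul_le_of_le_one_right (by positivity) ContinuousLinearMap.norm_id_le
    calc ‖Tr p - a‖ = ‖Tr (p - P) - (a - Tr P)‖ := by rw [map_sub]; congr 1; abel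
      _ ≤ ‖Tr (p - P)‖ + ‖a - Tr P‖ := norm_sub_le _ _
      _ ≤ 2⁻¹ ^ n + 2⁻¹ ^ n := add_le_add hnorm (hTrP ▸ hza n)
      _ = 2 * 2⁻¹ ^ n := (two_mul _).symm
  have hlim : Filter.Tendsto (fun n : ℕ => 2 * (2⁻¹ : ℝ) ^ n) Filter.atTop (nhds 0) := by
    simpa using (tendsto_pow_atTop_nhds_zero_of_lt_one (r := (2⁻¹ : ℝ)) (by norm_num)
      (by norm_num)).const_mul 2
  exact sub_eq_zero.1 (norm_le_zero_iff.1 (ge_of_tendsto' hlim hbound))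
end
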